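/- arXiv:1507.02608 — 2 statements merged into one kernel-verified Lean document; each statement's English description precedes it below -/
import Mathlib

section
/- A DAG H is not an independence map of a DAG G (i.e., the conditional independence constraints encoded by H are not a subset of those encoded by G) if and only if at least one of the following holds: (1) the skeleton of G is not a subgraph of the skeleton of H; or (2) there exists a triple of nodes (X_i, X_j, X_k) such that X_i and X_k are non-adjacent in H, the path (X_i, X_j, X_k) in H is a non-collider path, and (X_i, X_j, X_k) is a v-structure in G; or (3) there exists a triple (X_i, X_j, X_k) such that (X_i, X_j, X_k) is a v-structure in H, X_i is a non-descendant of X_k in H, and X_i is d-connected to X_k given the parents of X_k in G. -/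
/-- A directed acyclic graph on vertex set `Fin p`, given by its edge relation. -/
structure DAG (p : ℕ) where
  E : Fin p → Fin p → Prop
  acyclic : ∀ i, ¬ Relation.TransGen E i i

namespace DAG

variable {p : ℕ}

/-- `i` and `j` are adjacent. -/
def adj (G : DAG p) (i j : Fin p) : Prop := G.E i j ∨ G.E j i

/-- `j` is a descendant of `i` (each node is a descendant of itself). -/
def desc (G : DAG p) (i j : Fin p) : Prop := Relation.ReflTransGen G.E i j

/-- The set of non-descendants of `k`. -/
def nd (G : DAG p) (k : Fin p) : Set (Fin p) := {i | ¬ G.desc k i}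

/-- The set of parents of `k`. -/
def pa (G : DAG p) (k : Fin p) : Set (Fin p) := {i | G.E i k}

/-- `b` is a collider between `a` and `c` (on a path `a - b - c`). -/
def collider (G : DAG p) (a b c : Fin p) : Prop := G.E a b ∧ G.E c b

/-- `l` is a path from `i` to `k` in `G`: a list of pairwise distinct vertices, consecutive
vertices adjacent, starting at `i` and ending at `k`, with at least two vertices. -/
def IsPathList (G : DAG p) (l : List (Fin p)) (i k : Fin p) : Prop :=
  l.Nodup ∧ l.Chain' G.adj ∧ l.head? = some i ∧ l.getLast? = some k ∧ 2 ≤ l.length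

/-- The set `S` blocks the path `l`: some non-endpoint vertex of `l` is a non-collider in `S`,
or a collider having no descendant in `S`. -/
def blocked (G : DAG p) (S : Set (Fin p)) (l : List (Fin p)) : Prop :=
  ∃ (n : ℕ) (h : n + 2 < l.length),
    (G.collider (l.get ⟨n, by omega⟩) (l.get ⟨n + 1, by omega⟩) (l.get ⟨n + 2, h⟩) ∧
      ¬ ∃ d ∈ S, G.desc (l.get ⟨n + 1, by omega⟩) d) ∨
    (¬ G.collider (l.get ⟨n, by omega⟩) (l.get ⟨n + 1, by omega⟩) (l.get ⟨n + 2, h⟩) ∧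
      l.get ⟨n + 1, by omega⟩ ∈ S)

/-- `i` and `k` are d-connected given `S` in `G`. -/
def dConn (G : DAG p) (i k : Fin p) (S : Set (Fin p)) : Prop :=
  ∃ l, G.IsPathList l i k ∧ ¬ G.blocked S l

/-- `i` and `k` are d-separated by `S` in `G`. -/
def dSep (G : DAG p) (i k : Fin p) (S : Set (Fin p)) : Prop := ¬ G.dConn i k S

/-- The node sets `W₁` and `W₂` are d-separated by `S` in `G`. -/
def dSepSet (G : DAG p) (W₁ W₂ S : Set (Fin p)) : Prop :=
  ∀ i ∈ W₁, ∀ k ∈ W₂, G.dSep i k S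

/-- `H` is an independence map of `G`: every conditional independence constraint
(d-separation statement) encoded by `H` is also encoded by `G`. -/
def IndepMap (H G : DAG p) : Prop :=
  ∀ W₁ W₂ S : Set (Fin p), Disjoint W₁ W₂ → Disjoint W₁ S → Disjoint W₂ S →
    H.dSepSet W₁ W₂ S → G.dSepSet W₁ W₂ S

/-- The skeleton of `G` is a subgraph of the skeleton of `H`. -/
def skeletonSub (G H : DAG p) : Prop := ∀ i j, G.adj i j → H.adj i j

/-- `(i, j, k)` is a v-structure: `i → j ← k` with `i` and `k` non-adjacent. -/
def vstruct (G : DAG p) (i j k : Fin p) : Prop :=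
  G.E i j ∧ G.E k j ∧ ¬ G.adj i k ∧ i ≠ k

/-- `(i, j, k)` is a non-collider path of three (distinct) nodes in `H`. -/
def nonColliderTriple (H : DAG p) (i j k : Fin p) : Prop :=
  H.adj i j ∧ H.adj j k ∧ i ≠ k ∧ i ≠ j ∧ j ≠ k ∧ ¬ H.collider i j k

end DAG

namespace DAG

variable {p : ℕ}

/-- The walk `v 0, ..., v n` is active given `S`: an inner vertex is a collider iff it is in `S`. -/
def Act (G : DAG p) (S : Set (Fin p)) (v : ℕ → Fin p) (n : ℕ) : Prop :=
  (∀ m, m < n → G.adj (v m) (v (m + 1))) ∧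
    ∀ m, m + 2 ≤ n → (G.collider (v m) (v (m + 1)) (v (m + 2)) ↔ v (m + 1) ∈ S)

/-- There is an active walk. -/
def WC (G : DAG p) (S : Set (Fin p)) (a b : Fin p) : Prop :=
  ∃ (v : ℕ → Fin p) (n : ℕ), v 0 = a ∧ v n = b ∧ G.Act S v n

theorem adj_symm {G : DAG p} {a b : Fin p} (h : G.adj a b) : G.adj b a := h.symm

theorem no_two {G : DAG p} {a b : Fin p} (h : G.E a b) (h' : G.E b a) : False :=
  G.acyclic a (Relation.TransGen.tail (Relation.TransGen.single h) h')

theorem no_desc {G : DAG p} {a b : Fin p} (h : G.E a b) (h' : G.desc b a) : False :=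
  G.acyclic a (Relation.TransGen.head' h h')

theorem no_loop {G : DAG p} {a : Fin p} (h : G.E a a) : False := no_two h h

theorem ne_of_adj {G : DAG p} {a b : Fin p} (h : G.adj a b) : a ≠ b := by
  rintro rfl
  rcases h with h | h <;> exact no_loop h

theorem Act.sub {G : DAG p} {S : Set (Fin p)} {v : ℕ → Fin p} {n : ℕ} (h : G.Act S v n)
    (s t : ℕ) (hst : s + t ≤ n) : G.Act S (fun m => v (s + m)) t := by
  refine ⟨fun m hm => ?_, fun m hm => ?_⟩
  · exact h.1 (s + m) (by omega)
  · exact h.2 (s + m) (by omega)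

theorem Act.congr {G : DAG p} {S T : Set (Fin p)} {v : ℕ → Fin p} {n : ℕ} (h : G.Act S v n)
    (hST : ∀ m, 0 < m → m < n → (v m ∈ S ↔ v m ∈ T)) : G.Act T v n :=
  ⟨h.1, fun m hm => (h.2 m hm).trans (hST (m + 1) (by omega) (by omega))⟩

theorem Act.rev {G : DAG p} {S : Set (Fin p)} {v : ℕ → Fin p} {n : ℕ} (h : G.Act S v n) :
    G.Act S (fun m => v (n - m)) n := by
  refine ⟨fun m hm => ?_, fun m hm => ?_⟩
  · have := h.1 (n - (m + 1)) (by omega)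
    rw [show n - (m + 1) + 1 = n - m by omega] at this
    exact this.symm
  · have := h.2 (n - (m + 2)) (by omega)
    rw [show n - (m + 2) + 1 = n - (m + 1) by omega,
      show n - (m + 2) + 2 = n - m by omega] at this
    rw [← this]
    exact and_comm

theorem WC.symm {G : DAG p} {S : Set (Fin p)} {a b : Fin p} (h : G.WC S a b) : G.WC S b a := by
  obtain ⟨v, n, h0, hn, hA⟩ := h
  exact ⟨_, n, by simpa using hn, by simpa using h0, hA.rev⟩

theorem Act.concat {G : DAG p} {S : Set (Fin p)} {v w : ℕ → Fin p} {n m : ℕ} (h : G.Act S v n)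
    (h' : G.Act S w m) (hvw : v n = w 0)
    (hj : 0 < n → 0 < m → (G.collider (v (n - 1)) (v n) (w 1) ↔ v n ∈ S)) :
    G.WC S (v 0) (w m) := by
  refine ⟨fun j => if j ≤ n then v j else w (j - n), n + m, by simp, ?_, ?_, ?_⟩
  · rcases Nat.eq_zero_or_pos m with rfl | hm
    · simpa using hvw
    · simp [show ¬ n + m ≤ n by omega]
  · intro j hj'
    dsimp only
    rcases lt_trichotomy j n with hlt | rfl | hgt
    · rw [if_pos hlt.le, if_pos (by omega)]
      exact h.1 j hlt
    · rw [if_pos le_rfl, if_neg (by omega), hvw]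
      have := h'.1 0 (by omega)
      simpa using this
    · rw [if_neg (by omega), if_neg (by omega)]
      have := h'.1 (j - n) (by omega)
      rwa [show j - n + 1 = j + 1 - n by omega] at this
  · intro j hj'
    dsimp only
    rcases lt_trichotomy (j + 1) n with hlt | heq | hgt
    · rw [if_pos (by omega), if_pos (by omega), if_pos (by omega)]
      exact h.2 j (by omega)
    · rw [if_pos (by omega), if_pos (by omega), if_neg (by omega)]
      have := hj (by omega) (by omega)
      rw [show n - 1 = j by omega, ← heq] at this
      rwa [show j + 2 - n = 1 by omega]
    · rcases Nat.lt_or_ge n j with hn | hn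
      · rw [if_neg (by omega), if_neg (by omega), if_neg (by omega)]
        have := h'.2 (j - n) (by omega)
        rwa [show j - n + 1 = j + 1 - n by omega, show j - n + 2 = j + 2 - n by omega] at this
      · have hjn : j = n := by omega
        subst hjn
        rw [if_pos (by omega), if_neg (by omega), if_neg (by omega), hvw]
        have := h'.2 0 (by omega)
        rwa [show j + 1 - j = 0 + 1 by omega, show j + 2 - j = 0 + 2 by omega]

theorem Act.single {G : DAG p} {S : Set (Fin p)} {a b : Fin p} (h : G.adj a b) :
    G.Act S (fun m => if m = 0 then a else b) 1 := by
  refine ⟨fun m hm => ?_, fun m hm => by omega⟩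
  have : m = 0 := by omega
  subst this
  simpa using h

/-! ### From walks to paths -/

/-- Generalized activity. -/
def Act' (G : DAG p) (S : Set (Fin p)) (v : ℕ → Fin p) (n : ℕ) : Prop :=
  (∀ m, m < n → G.adj (v m) (v (m + 1))) ∧
    ∀ m, m + 2 ≤ n →
      (G.collider (v m) (v (m + 1)) (v (m + 2)) → ∃ d ∈ S, G.desc (v (m + 1)) d) ∧
      (¬ G.collider (v m) (v (m + 1)) (v (m + 2)) → v (m + 1) ∉ S)

theorem Act'.fwd {G : DAG p} {S : Set (Fin p)} {v : ℕ → Fin p} {n : ℕ} (h : G.Act' S v n)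
    {s : ℕ} (hs : G.E (v s) (v (s + 1))) (hS : ¬ ∃ d ∈ S, G.desc (v s) d) :
    ∀ j, s + 1 + j ≤ n → G.E (v (s + j)) (v (s + j + 1)) ∧ G.desc (v s) (v (s + j)) := by
  intro j
  induction j with
  | zero => intro _; exact ⟨hs, Relation.ReflTransGen.refl⟩
  | succ j ih =>
    intro hj
    obtain ⟨h1, h2⟩ := ih (by omega)
    have h3 : G.desc (v s) (v (s + j + 1)) := h2.tail h1
    refine ⟨?_, h3⟩
    rcases h.1 (s + j + 1) (by omega) with h4 | h4
    · exact h4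
    · exfalso
      obtain ⟨d, hd, hd'⟩ := (h.2 (s + j) (by omega)).1 ⟨h1, h4⟩
      exact hS ⟨d, hd, h3.trans hd'⟩

theorem path_of_act' {G : DAG p} {S : Set (Fin p)} {a b : Fin p} (hab : a ≠ b) :
    ∀ (n : ℕ) (v : ℕ → Fin p), v 0 = a → v n = b → G.Act' S v n → G.dConn a b S := by
  intro n
  induction n using Nat.strong_induction_on with
  | _ n ih =>
  intro v h0 hn hA
  by_cases hinj : ∀ s t, s < t → t ≤ n → v s ≠ v t
  · refine ⟨(List.range (n + 1)).map v, ⟨?_, ?_, ?_, ?_, ?_⟩, ?_⟩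
    · refine List.Nodup.map_on ?_ List.nodup_range
      intro x hx y hy hxy
      rw [List.mem_range] at hx hy
      rcases lt_trichotomy x y with h | h | h
      · exact absurd hxy (hinj x y h (by omega))
      · exact h
      · exact absurd hxy.symm (hinj y x h (by omega))
    · refine List.isChain_iff_getElem.2 ?_
      intro i hi
      simp only [List.length_map, List.length_range] at hi
      simpa using hA.1 i (by omega)
    · simp [List.head?_range, h0]
    · simp [List.getLast?_range, hn]
    · have : n ≠ 0 := by
        rintro rfl
        exact hab (h0.symm.trans hn)
      simp
      omega
    · rintro ⟨m, hm, hb⟩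
      simp only [List.length_map, List.length_range] at hm
      simp only [List.get_eq_getElem, List.getElem_map, List.getElem_range] at hb
      have := hA.2 m (by omega)
      rcases hb with ⟨hb1, hb2⟩ | ⟨hb1, hb2⟩
      · exact hb2 (this.1 hb1)
      · exact this.2 hb1 hb2
  · push Not at hinj
    obtain ⟨s, t, hst, htn, hv⟩ := hinj
    -- cut the walk
    have key : ∀ w : ℕ → Fin p, (w = fun j => if j ≤ s then v j else v (j + (t - s))) →
        G.dConn a b S := by
      intro w hw
      have hlo : ∀ j, j ≤ s → w j = v j := fun j hj => by rw [hw]; simp [hj]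
      have hhi : ∀ j, s ≤ j → w j = v (j + (t - s)) := fun j hj => by
        rw [hw]
        rcases Nat.lt_or_ge s j with h | h
        · simp [show ¬ j ≤ s by omega]
        · have : j = s := by omega
          subst this
          simp [hv, show j + (t - j) = t by omega]
      refine ih (n - (t - s)) (by omega) w (by rw [hlo 0 (by omega), h0]) ?_ ⟨?_, ?_⟩
      · rw [hhi _ (by omega), show n - (t - s) + (t - s) = n by omega, hn]
      · intro m hm
        rcases Nat.lt_or_ge m s with h | h
        · rw [hlo m h.le, hlo (m + 1) h]
          exact hA.1 m (by omega)
        · rw [hhi m h, hhi (m + 1) (by omega), show m + 1 + (t - s) = m + (t - s) + 1 by omega]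
          exact hA.1 _ (by omega)
      · intro m hm
        rcases lt_trichotomy (m + 1) s with h | h | h
        · rw [hlo m (by omega), hlo (m + 1) (by omega), hlo (m + 2) (by omega)]
          exact hA.2 m (by omega)
        · rw [hlo m (by omega), hlo (m + 1) (by omega), hhi (m + 2) (by omega)]
          have e1 : m + 2 + (t - s) = t + 1 := by omega
          rw [e1]
          have hvt : v (m + 1) = v t := by rw [h, hv]
          have A1 := hA.2 m (by omega)
          have A2 := hA.2 (t - 1) (by omega)
          rw [show t - 1 + 1 = t by omega, show t - 1 + 2 = t + 1 by omega] at A2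
          have A3 := hA.1 m (by omega)
          have A4 := hA.1 t (by omega)
          constructor
          · rintro ⟨c1, c2⟩
            by_contra hS
            have n1 : ¬ G.collider (v m) (v (m + 1)) (v (m + 2)) := fun hc => hS (A1.1 hc)
            have n2 : G.E (v (m + 1)) (v (m + 1 + 1)) := by
              rcases hA.1 (m + 1) (by omega) with h' | h'
              · exact h'
              · exact absurd ⟨c1, h'⟩ n1
            have n3 := (hA.fwd n2 hS (t - s - 1) (by omega)).1
            rw [show m + 1 + (t - s - 1) = t - 1 by omega, show t - 1 + 1 = t by omega] at n3
            rw [hvt] at c2 hS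
            exact hS (A2.1 ⟨n3, c2⟩)
          · intro hc hS
            have c1 : G.collider (v m) (v (m + 1)) (v (m + 2)) := by
              by_contra h'
              exact A1.2 h' hS
            have c2 : G.collider (v (t - 1)) (v t) (v (t + 1)) := by
              by_contra h'
              exact A2.2 h' (hvt ▸ hS)
            exact hc ⟨c1.1, by rw [hvt]; exact c2.2⟩
        · rw [hhi m (by omega), hhi (m + 1) (by omega), hhi (m + 2) (by omega),
            show m + 1 + (t - s) = m + (t - s) + 1 by omega,
            show m + 2 + (t - s) = m + (t - s) + 2 by omega]
          exact hA.2 _ (by omega)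
    exact key _ rfl

theorem dConn_of_wc {G : DAG p} {S : Set (Fin p)} {a b : Fin p} (hab : a ≠ b)
    (h : G.WC S a b) : G.dConn a b S := by
  obtain ⟨v, n, h0, hn, hA⟩ := h
  refine path_of_act' hab n v h0 hn ⟨hA.1, fun m hm => ⟨fun hc => ?_, fun hc => ?_⟩⟩
  · exact ⟨_, (hA.2 m hm).1 hc, Relation.ReflTransGen.refl⟩
  · exact fun hmem => hc ((hA.2 m hm).2 hmem)

/-! ### From paths to walks -/

/-- Reachability by active walks, with the mark at the last vertex (`True` = arrowhead). -/
inductive Reach (G : DAG p) (S : Set (Fin p)) (a : Fin p) : Bool → Fin p → Prop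
  | start : a ∉ S → Reach G S a false a
  | fwd {d v w} : Reach G S a d v → v ∉ S → G.E v w → Reach G S a true w
  | bwd {v w} : Reach G S a false v → v ∉ S → G.E w v → Reach G S a false w
  | col {v w} : Reach G S a true v → v ∈ S → G.E w v → Reach G S a false w

theorem Reach.collider {G : DAG p} {S : Set (Fin p)} {a v d : Fin p} (hd : d ∈ S)
    (h : G.desc v d) : G.Reach S a true v → ∀ w, G.E w v → G.Reach S a false w := by
  induction h using Relation.ReflTransGen.head_induction_on with
  | refl => intro hr w hw; exact .col hr hd hw
  | head h' _ ih =>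
    intro hr w hw
    rename_i x y _
    by_cases hx : x ∈ S
    · exact .col hr hx hw
    · exact .bwd (ih (.fwd hr hx h') x h') hx hw

theorem Reach.walk {G : DAG p} {S : Set (Fin p)} {a : Fin p} {d : Bool} {b : Fin p}
    (h : G.Reach S a d b) : ∃ (v : ℕ → Fin p) (n : ℕ), v 0 = a ∧ v n = b ∧ G.Act S v n ∧
      (d = true → 0 < n ∧ G.E (v (n - 1)) (v n)) ∧
      (d = false → 0 < n → G.E (v n) (v (n - 1))) := by
  -- extension by one step
  have ext : ∀ (v : ℕ → Fin p) (n : ℕ) (w : Fin p), G.Act S v n → G.adj (v n) w →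
      (0 < n → (G.collider (v (n - 1)) (v n) w ↔ v n ∈ S)) →
      ∃ u : ℕ → Fin p, u 0 = v 0 ∧ u n = v n ∧ u (n + 1) = w ∧ G.Act S u (n + 1) := by
    intro v n w hA hadj hc
    have hlo : ∀ j, j ≤ n → (fun j => if j ≤ n then v j else w) j = v j := fun j hj => by
      simp [hj]
    have hhi : (fun j => if j ≤ n then v j else w) (n + 1) = w := by simp
    generalize (fun j => if j ≤ n then v j else w) = u at hlo hhi
    refine ⟨u, hlo 0 (by omega), hlo n le_rfl, hhi, ?_, ?_⟩
    · intro m hm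
      rcases Nat.lt_or_ge m n with h | h
      · rw [hlo m h.le, hlo (m + 1) h]
        exact hA.1 m h
      · have : m = n := by omega
        subst this
        rw [hlo m le_rfl, hhi]
        exact hadj
    · intro m hm
      rcases Nat.lt_or_ge (m + 1) n with h | h
      · rw [hlo m (by omega), hlo (m + 1) (by omega), hlo (m + 2) (by omega)]
        exact hA.2 m h
      · have : n = m + 1 := by omega
        subst this
        rw [hlo m (by omega), hlo (m + 1) (by omega), hhi]
        exact hc (by omega)
  induction h with
  | start h => exact ⟨fun _ => a, 0, rfl, rfl, ⟨by omega, by omega⟩, by simp, by simp⟩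
  | fwd h1 h2 h3 ih =>
    obtain ⟨v, n, h0, hn, hA, -, -⟩ := ih
    subst hn
    obtain ⟨u, u0, un, u1, hu⟩ := ext v n _ hA (Or.inl h3)
      (fun _ => ⟨fun hc => (no_two hc.2 h3).elim, fun hc => absurd hc h2⟩)
    exact ⟨u, n + 1, u0.trans h0, u1, hu, fun _ => ⟨by omega, by simpa [un, u1] using h3⟩,
      by simp⟩
  | bwd h1 h2 h3 ih =>
    obtain ⟨v, n, h0, hn, hA, -, hf⟩ := ih
    subst hn
    obtain ⟨u, u0, un, u1, hu⟩ := ext v n _ hA (Or.inr h3)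
      (fun hpos => ⟨fun hc => (no_two hc.1 (hf rfl hpos)).elim, fun hc => absurd hc h2⟩)
    exact ⟨u, n + 1, u0.trans h0, u1, hu, by simp, fun _ _ => by simpa [un, u1] using h3⟩
  | col h1 h2 h3 ih =>
    obtain ⟨v, n, h0, hn, hA, ht, -⟩ := ih
    subst hn
    obtain ⟨u, u0, un, u1, hu⟩ := ext v n _ hA (Or.inr h3)
      (fun hpos => ⟨fun hc => h2, fun hc => ⟨(ht rfl).2, h3⟩⟩)
    exact ⟨u, n + 1, u0.trans h0, u1, hu, by simp, fun _ _ => by simpa [un, u1] using h3⟩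

theorem wc_of_dConn {G : DAG p} {S : Set (Fin p)} {a b : Fin p} (ha : a ∉ S)
    (h : G.dConn a b S) : G.WC S a b := by
  obtain ⟨l, ⟨-, hch, hhd, hlast, hlen⟩, hbl⟩ := h
  have hch' : ∀ (i : ℕ) (h : i + 1 < l.length), G.adj l[i] l[i + 1] :=
    List.isChain_iff_getElem.1 hch
  have h0 : l[0] = a := by
    rw [List.head?_eq_getElem?, List.getElem?_eq_getElem (by omega)] at hhd
    simpa using hhd
  have hl : l[l.length - 1] = b := by
    rw [List.getLast?_eq_getElem?, List.getElem?_eq_getElem (by omega)] at hlast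
    simpa using hlast
  have key : ∀ (i : ℕ) (h : i + 1 < l.length),
      (G.E l[i] l[i + 1] → G.Reach S a true l[i + 1]) ∧
      (G.E l[i + 1] l[i] → G.Reach S a false l[i + 1]) := by
    intro i
    induction i with
    | zero =>
      intro h
      have hs : G.Reach S a false l[0] := by rw [h0]; exact .start ha
      have hS : l[0] ∉ S := by rw [h0]; exact ha
      exact ⟨fun hE => .fwd hs hS hE, fun hE => .bwd hs hS hE⟩
    | succ i ih =>
      intro h
      have ih := ih (by omega)
      have hb : ¬ ((G.collider l[i] l[i + 1] l[i + 2] ∧ ¬ ∃ d ∈ S, G.desc l[i + 1] d) ∨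
          (¬ G.collider l[i] l[i + 1] l[i + 2] ∧ l[i + 1] ∈ S)) :=
        fun hb => hbl ⟨i, h, hb⟩
      push Not at hb
      obtain ⟨hb1, hb2⟩ := hb
      constructor
      · intro hE
        have hn : l[i + 1] ∉ S := hb2 (fun hc => no_two hE hc.2)
        rcases hch' i (by omega) with h' | h'
        · exact .fwd (ih.1 h') hn hE
        · exact .fwd (ih.2 h') hn hE
      · intro hE
        rcases hch' i (by omega) with h' | h'
        · obtain ⟨d, hd, hd'⟩ := hb1 ⟨h', hE⟩
          exact Reach.collider hd hd' (ih.1 h') _ hE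
        · exact .bwd (ih.2 h') (hb2 (fun hc => no_two h' hc.1)) hE
  have hr : ∃ d, G.Reach S a d b := by
    have hk := key (l.length - 2) (by omega)
    have ha := hch' (l.length - 2) (by omega)
    have e : l[l.length - 2 + 1] = b := by
      rw [← hl]; congr 1; omega
    rw [e] at hk ha
    rcases ha with h' | h'
    · exact ⟨_, hk.1 h'⟩
    · exact ⟨_, hk.2 h'⟩
  obtain ⟨d, hd⟩ := hr
  obtain ⟨v, n, h1, h2, h3, -⟩ := hd.walk
  exact ⟨v, n, h1, h2, h3⟩

/-! ### Local Markov property of d-separation -/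

theorem local_markov {H : DAG p} {i k : Fin p} (hne : i ≠ k) (hnd : ¬ H.desc k i)
    (hp : ¬ H.E i k) : ¬ H.WC (H.pa k) k i := by
  rintro ⟨v, n, h0, hn, hA⟩
  have hpos : n ≠ 0 := by rintro rfl; exact hne (hn.symm.trans h0)
  have key : ∀ j, j < n → H.E (v j) (v (j + 1)) ∧ H.desc k (v (j + 1)) := by
    intro j
    induction j with
    | zero =>
      intro hj
      have hE : H.E (v 0) (v 1) := by
        rcases hA.1 0 hj with h | h
        · exact h
        · exfalso
          rw [h0] at h
          rcases Nat.lt_or_ge 1 n with h1 | h1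
          · have := ((hA.2 0 h1).2 h).1
            rw [h0] at this
            exact no_two this h
          · have : n = 1 := by omega
            subst this
            rw [zero_add, hn] at h
            exact hp h
      refine ⟨hE, ?_⟩
      rw [h0] at hE
      exact Relation.ReflTransGen.single hE
    | succ j ih =>
      intro hj
      obtain ⟨h1, h2⟩ := ih (by omega)
      have hE : H.E (v (j + 1)) (v (j + 1 + 1)) := by
        rcases hA.1 (j + 1) hj with h | h
        · exact h
        · exact (no_desc ((hA.2 j (by omega)).1 ⟨h1, h⟩) h2).elim
      exact ⟨hE, h2.tail hE⟩
  have := (key (n - 1) (by omega)).2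
  rw [show n - 1 + 1 = n by omega, hn] at this
  exact hnd this

/-! ### Graphoid axioms -/

theorem weak_union {G : DAG p} {C W : Set (Fin p)} {a b : Fin p} (h : ¬ G.WC C a b)
    (hw : ∀ w ∈ W, w ∉ C → ¬ G.WC C a w) : ¬ G.WC (C ∪ W) a b := by
  classical
  rintro ⟨v, n, h0, hn, hA⟩
  by_cases hex : ∃ m, 0 < m ∧ m < n ∧ v m ∈ W ∧ v m ∉ C
  · obtain ⟨h1, h2, h3, h4⟩ := Nat.find_spec hex
    have hmin := fun m => Nat.find_min (H := hex) (m := m)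
    generalize Nat.find hex = m at h1 h2 h3 h4 hmin
    refine hw _ h3 h4 ⟨v, m, h0, rfl, ?_⟩
    have := hA.sub 0 m (by omega)
    simp only [zero_add] at this
    refine this.congr (fun j hj hj' => ?_)
    have := hmin j hj'
    have : v j ∈ W → v j ∈ C := by
      intro hW; by_contra hC; exact this ⟨hj, by omega, hW, hC⟩
    simp only [Set.mem_union]
    tauto
  · refine h ⟨v, n, h0, hn, hA.congr (fun j hj hj' => ?_)⟩
    have : v j ∈ W → v j ∈ C := by
      intro hW; by_contra hC; exact hex ⟨j, hj, by omega, hW, hC⟩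
    simp only [Set.mem_union]
    tauto

theorem contraction {G : DAG p} {C W : Set (Fin p)} {a b : Fin p} (h : ¬ G.WC (C ∪ W) a b)
    (hw : ∀ w ∈ W, w ∉ C → ¬ G.WC C a w) : ¬ G.WC C a b := by
  rintro ⟨v, n, h0, hn, hA⟩
  by_cases hex : ∃ m, 0 < m ∧ m < n ∧ v m ∈ W ∧ v m ∉ C
  · obtain ⟨m, h1, h2, h3, h4⟩ := hex
    refine hw _ h3 h4 ⟨v, m, h0, rfl, ?_⟩
    have := hA.sub 0 m (by omega)
    simpa only [zero_add] using this
  · refine h ⟨v, n, h0, hn, hA.congr (fun j hj hj' => ?_)⟩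
    have : v j ∈ W → v j ∈ C := by
      intro hW; by_contra hC; exact hex ⟨j, hj, by omega, hW, hC⟩
    simp only [Set.mem_union]
    tauto

/-! ### Topological numbering -/

theorem exists_top (H : DAG p) : ∃ f : Fin p → ℕ, Function.Injective f ∧
    ∀ i j, H.E i j → f i < f j := by
  classical
  let c : Fin p → ℕ := fun i => (Finset.univ.filter (fun j => Relation.TransGen H.E j i)).card
  have hc : ∀ i j, H.E i j → c i < c j := by
    intro i j hij
    refine Finset.card_lt_card ?_
    rw [Finset.ssubset_iff_of_subset]
    · exact ⟨i, by simpa using Relation.TransGen.single hij, by simpa using H.acyclic i⟩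
    · intro x hx
      simp only [Finset.mem_filter, Finset.mem_univ, true_and] at hx ⊢
      exact hx.tail hij
  refine ⟨fun i => i.1 + p * c i, ?_, ?_⟩
  · intro i j hij
    have := congrArg (· % p) hij
    simp only [Nat.add_mul_mod_self_left, Nat.mod_eq_of_lt i.2, Nat.mod_eq_of_lt j.2] at this
    exact Fin.ext this
  · intro i j hij
    have h1 := Nat.mul_le_mul_left p (hc i j hij)
    have h2 := i.2
    have h3 : p * (c i).succ = p * c i + p := Nat.mul_succ _ _
    dsimp only
    omega

theorem f_desc {H : DAG p} {f : Fin p → ℕ} (hf : ∀ i j, H.E i j → f i < f j) {a b : Fin p}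
    (h : H.desc a b) : f a ≤ f b := by
  induction h with
  | refl => exact le_rfl
  | tail _ h ih => exact ih.trans (hf _ _ h).le

theorem top_walk {H : DAG p} {f : Fin p → ℕ} (hf : ∀ i j, H.E i j → f i < f j)
    {C : Set (Fin p)} {v : ℕ → Fin p} {n M : ℕ} (hA : H.Act C v n) (hC : ∀ c ∈ C, f c < M)
    (h0 : f (v 0) ≤ M) (hn : f (v n) ≤ M) : ∀ j, 0 < j → j < n → f (v j) < M := by
  intro j hj hjn
  obtain ⟨m, hm, hmax⟩ := Finset.exists_max_image (Finset.Ioo 0 n) (fun j => f (v j))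
    ⟨j, by simp [hj, hjn]⟩
  rw [Finset.mem_Ioo] at hm
  refine lt_of_le_of_lt (hmax j (by simp [hj, hjn])) ?_
  by_contra hM
  push Not at hM
  have hall : ∀ x, x ≤ n → f (v x) ≤ f (v m) := by
    intro x hx
    rcases Nat.eq_zero_or_pos x with rfl | hx0
    · exact h0.trans hM
    · rcases Nat.lt_or_ge x n with hxn | hxn
      · exact hmax x (by simp [hx0, hxn])
      · have : x = n := by omega
        subst this
        exact hn.trans hM
  obtain ⟨m, rfl⟩ : ∃ m', m = m' + 1 := ⟨m - 1, by omega⟩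
  have e1 : H.E (v m) (v (m + 1)) := by
    rcases hA.1 m (by omega) with h | h
    · exact h
    · have := hf _ _ h
      have := hall m (by omega)
      omega
  have e2 : H.E (v (m + 2)) (v (m + 1)) := by
    rcases hA.1 (m + 1) (by omega) with h | h
    · have := hf _ _ h
      have := hall (m + 1 + 1) (by omega)
      omega
    · exact h
  have := hC _ ((hA.2 m (by omega)).1 ⟨e1, e2⟩)
  omega

/-! ### Local implies global -/

theorem global_of_local {H G : DAG p} {f : Fin p → ℕ} (hinj : Function.Injective f)
    (hf : ∀ i j, H.E i j → f i < f j)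
    (hloc : ∀ k i, ¬ H.desc k i → ¬ H.E i k → ¬ G.WC (H.pa k) k i) :
    ∀ (M : ℕ) (a b : Fin p) (C : Set (Fin p)), a ≠ b → a ∉ C → b ∉ C → f a < M → f b < M →
      (∀ c ∈ C, f c < M) → ¬ H.WC C a b → ¬ G.WC C a b := by
  intro M
  induction M with
  | zero => intro a b C _ _ _ h; omega
  | succ M ih =>
  -- the case where one endpoint is the last vertex
  have case2 : ∀ (z b : Fin p) (C : Set (Fin p)), f z = M → f b < M → (∀ c ∈ C, f c < M) →
      b ∉ C → ¬ H.WC C z b → ¬ G.WC C z b := by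
    intro z b C hz hb hC hbC hH hG
    have hbz : ¬ H.E b z := fun h => hH ⟨_, 1, by simp, by simp, Act.single (Or.inr h)⟩
    refine contraction (C := C) (W := H.pa z) (a := b) (b := z) ?_ ?_ hG.symm
    · intro h
      rw [Set.union_comm] at h
      refine weak_union (C := H.pa z) (W := C) (a := z) (b := b) ?_ ?_ h.symm
      · refine hloc z b (fun hd => ?_) hbz
        have := f_desc hf hd
        omega
      · intro c hc hcp
        refine hloc z c (fun hd => ?_) hcp
        have := f_desc hf hd
        have := hC c hc
        omega
    · intro q hq hqC
      have hqM : f q < M := hz ▸ hf _ _ hq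
      refine ih b q C ?_ hbC hqC hb hqM hC ?_
      · rintro rfl; exact hbz hq
      · intro hw
        obtain ⟨v, n, h0, hn, hA⟩ := hw.symm
        have := Act.concat (Act.single (S := C) (G := H) (a := z) (b := q) (Or.inr hq)) hA
          (by simp [h0]) (by
            intro _ _
            simp only [one_ne_zero, if_false, Nat.sub_self, if_true]
            exact ⟨fun hc => (no_two hc.1 hq).elim, fun hc => absurd hc hqC⟩)
        rw [hn] at this
        exact hH (by simpa using this)
  intro a b C hab haC hbC ha hb hC hH
  by_cases haM : f a = M
  · have hbM : f b < M := by
      have : f b ≠ M := fun h => hab (hinj (haM.trans h.symm))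
      omega
    refine case2 a b C haM hbM ?_ hbC hH
    intro c hc
    have : f c ≠ M := fun h => haC (hinj (haM.trans h.symm) ▸ hc)
    have := hC c hc
    omega
  by_cases hbM : f b = M
  · intro hG
    refine case2 b a C hbM (by omega) ?_ haC (fun h => hH h.symm) hG.symm
    intro c hc
    have : f c ≠ M := fun h => hbC (hinj (hbM.trans h.symm) ▸ hc)
    have := hC c hc
    omega
  by_cases hz : ∃ z ∈ C, f z = M
  · obtain ⟨z, hzC, hzM⟩ := hz
    have hC' : ∀ c ∈ C \ {z}, f c < M := by
      rintro c ⟨hc, hcz⟩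
      have : f c ≠ M := fun h => hcz (hinj (h.trans hzM.symm))
      have := hC c hc
      omega
    have haz : a ≠ z := fun h => haM (h ▸ hzM)
    have hbz : b ≠ z := fun h => hbM (h ▸ hzM)
    have hconv : ∀ (v : ℕ → Fin p) (n : ℕ), H.Act (C \ {z}) v n → f (v 0) ≤ M → f (v n) ≤ M →
        H.Act C v n := by
      intro v n hA h0 hn
      refine hA.congr (fun j hj hj' => ?_)
      have := top_walk hf hA hC' h0 hn j hj hj'
      have : v j ≠ z := by intro h; rw [h] at this; omega
      simp [this]
    have hH1 : ¬ H.WC (C \ {z}) a b := by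
      rintro ⟨v, n, h0, hn, hA⟩
      exact hH ⟨v, n, h0, hn, hconv v n hA (by rw [h0]; omega) (by rw [hn]; omega)⟩
    have hG1 : ¬ G.WC (C \ {z}) a b :=
      ih a b _ hab (fun h => haC h.1) (fun h => hbC h.1) (by omega) (by omega) hC' hH1
    have hCz : C \ {z} ∪ {z} = C := by
      ext x
      by_cases hx : x = z
      · simp [hx, hzC]
      · simp [hx]
    have hor : ¬ H.WC (C \ {z}) z a ∨ ¬ H.WC (C \ {z}) z b := by
      by_contra hcon
      push Not at hcon
      obtain ⟨h1, ⟨w, m, w0, wm, hw⟩⟩ := hcon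
      obtain ⟨v, n, v0, vn, hv⟩ := h1.symm
      have edge : ∀ (u : ℕ → Fin p) (l j j' : ℕ), H.Act (C \ {z}) u l → f (u 0) ≤ M →
          f (u l) ≤ M → j ≤ l → f (u j) ≠ M → H.adj (u j) (u j') → u j' = z →
          H.E (u j) (u j') := by
        intro u l j j' hu h0 hl hj hne hadj hz
        rcases hadj with h | h
        · exact h
        · have h1 := hf _ _ h
          rw [hz, hzM] at h1
          exfalso
          rcases Nat.eq_zero_or_pos j with rfl | hj0
          · omega
          · rcases Nat.lt_or_ge j l with hjl | hjl
            · have := top_walk hf hu hC' h0 hl j hj0 hjl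
              omega
            · have : j = l := by omega
              subst this
              omega
      have hA1 := hconv v n hv (by rw [v0]; omega) (by rw [vn]; omega)
      have hA2 := hconv w m hw (by rw [w0]; omega) (by rw [wm]; omega)
      have := Act.concat hA1 hA2 (by rw [vn, w0]) (by
        intro hn hm
        rw [vn]
        refine ⟨fun _ => hzC, fun _ => ⟨?_, ?_⟩⟩
        · have h1 := hA1.1 (n - 1) (by omega)
          rw [show n - 1 + 1 = n by omega] at h1
          rw [← vn]
          have hne : f (v (n - 1)) ≠ M := fun h =>
            ne_of_adj h1 (hinj (by rw [h, vn, hzM]))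
          exact edge v n _ n hv (by rw [v0]; omega) (by rw [vn]; omega) (by omega) hne h1 vn
        · have h1 := adj_symm (hA2.1 0 (by omega))
          rw [← w0]
          have hne : f (w 1) ≠ M := fun h =>
            ne_of_adj h1 (hinj (by rw [zero_add, h, w0, hzM]))
          exact edge w m 1 0 hw (by rw [w0]; omega) (by rw [wm]; omega) (by omega) hne h1 w0)
      rw [v0, wm] at this
      exact hH this
    rcases hor with h | h
    · have h2 := case2 z a _ hzM (by omega) hC' (fun h => haC h.1) h
      have := weak_union (W := {z}) hG1 (by
        rintro w rfl _ h'
        exact h2 h'.symm)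
      rwa [hCz] at this
    · have h2 := case2 z b _ hzM (by omega) hC' (fun h => hbC h.1) h
      have := weak_union (W := {z}) (fun h => hG1 (WC.symm h)) (by
        rintro w rfl _ h'
        exact h2 h'.symm)
      rw [hCz] at this
      exact fun h => this h.symm
  · refine ih a b C hab haC hbC (by omega) (by omega) ?_ hH
    intro c hc
    have : f c ≠ M := fun h => hz ⟨c, hc, h⟩
    have := hC c hc
    omega

/-! ### The main argument -/

theorem seg {H G : DAG p} {f : Fin p → ℕ} (hf : ∀ i j, H.E i j → f i < f j)
    (h1 : skeletonSub G H)
    (h2 : ∀ i j k, G.E i j → G.E k j → i ≠ k → ¬ H.adj i k → H.collider i j k)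
    (h3 : ∀ i j k, H.vstruct i j k → ¬ H.desc k i → ¬ G.WC (H.pa k) i k)
    {k : Fin p} {v : ℕ → Fin p} {n : ℕ} (hA : G.Act (H.pa k) v n)
    (_hi : ¬ H.desc k (v n))
    (hint : ∀ m, m < n → H.desc k (v m) ∨ v m ∈ H.pa k) :
    ∀ L s t, t ≤ s + L → s < t → t ≤ n → H.desc k (v s) → (H.desc k (v t) ∨ t = n) →
      (∀ m, s < m → m < t → H.desc k (v m) →
        f (v s) ≤ f (v m) ∧ (H.desc k (v t) → f (v t) ≤ f (v m))) →
      (v s = v t ∨ H.adj (v s) (v t)) ∧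
      ∀ m, s < m → m < t → v m ∈ H.pa k →
        H.E (v m) (v s) ∧ (H.desc k (v t) → H.E (v m) (v t)) := by
  have hexc : ∀ x, H.desc k x → x ∈ H.pa k → False := fun _ hdesc hpar => no_desc hpar hdesc
  -- orientation of edges between `D` and its complement
  have orient : ∀ x y, ¬ H.desc k x → H.desc k y → H.adj x y → H.E x y := by
    intro x y hx hy hxy
    rcases hxy with h | h
    · exact h
    · exact absurd (hy.tail h) hx
  have orientf : ∀ x y, f x ≤ f y → H.adj x y → H.E x y := by
    intro x y hx hxy
    rcases hxy with h | h
    · exact h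
    · have := hf _ _ h
      omega
  -- activity of segments
  have act : ∀ x s t, s ≤ t → t ≤ n →
      (∀ m, s < m → m < t → H.desc k (v m) → f x ≤ f (v m)) →
      (∀ m, s < m → m < t → v m ∈ H.pa k → H.E (v m) x) →
      G.WC (H.pa x) (v s) (v t) := by
    intro x s t hst htn hD hP
    refine ⟨fun m => v (s + m), t - s, rfl, by simp [show s + (t - s) = t by omega], ?_⟩
    refine (hA.sub s (t - s) (by omega)).congr (fun m hm hm' => ?_)
    refine ⟨fun h => hP _ (by omega) (by omega) h, fun h => ?_⟩
    rcases hint (s + m) (by omega) with hd | hd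
    · have := hD _ (by omega) (by omega) hd
      have := hf _ _ h
      omega
    · exact hd
  intro L
  induction L with
  | zero => intro s t h h'; omega
  | succ L ih =>
  intro s t hL hst htn hs ht hD
  by_cases hex : ∃ r ∈ Finset.Ioo s t, H.desc k (v r)
  · classical
    obtain ⟨r, hr, hmin⟩ := Finset.exists_min_image
      ((Finset.Ioo s t).filter (fun r => H.desc k (v r))) (fun r => f (v r)) (by
        obtain ⟨r, hr, hr'⟩ := hex
        exact ⟨r, Finset.mem_filter.2 ⟨hr, hr'⟩⟩)
    simp only [Finset.mem_filter, Finset.mem_Ioo] at hr hmin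
    obtain ⟨⟨hsr, hrt⟩, hrD⟩ := hr
    have hfr := hD r hsr hrt hrD
    obtain ⟨a1, p1⟩ := ih s r (by omega) hsr (by omega) hs (Or.inl hrD)
      (fun m hm hm' hmD => ⟨(hD m hm (by omega) hmD).1,
        fun _ => hmin m ⟨⟨hm, by omega⟩, hmD⟩⟩)
    obtain ⟨a2, p2⟩ := ih r t (by omega) hrt htn hrD ht
      (fun m hm hm' hmD => ⟨hmin m ⟨⟨by omega, hm'⟩, hmD⟩,
        (hD m (by omega) hm' hmD).2⟩)
    have q1 : ∀ m, s < m → m < t → v m ∈ H.pa k → H.E (v m) (v s) := by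
      intro m
      induction m using Nat.strong_induction_on with
      | _ m ihm =>
      intro hsm hmt hmP
      rcases lt_trichotomy m r with h | h | h
      · exact (p1 m hsm h hmP).1
      · subst h
        exact (hexc _ hrD hmP).elim
      · have hmz := (p2 m h hmt hmP).1
        have hmD : ¬ H.desc k (v m) := fun hd => hexc _ hd hmP
        rcases a1 with a1 | a1
        · rw [a1]; exact hmz
        · have hsz := orientf _ _ hfr.1 a1
          by_contra hno
          have hnadj : ¬ H.adj (v m) (v s) := fun hadj => hno (orient _ _ hmD hs hadj)
          refine h3 (v m) (v r) (v s) ⟨hmz, hsz, hnadj, ?_⟩ ?_ (WC.symm ?_)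
          · intro h; rw [h] at hmD; exact hmD hs
          · exact fun hd => hmD (hs.trans hd)
          · exact act (v s) s m hsm.le (by omega)
              (fun j hj hj' hjD => (hD j hj (by omega) hjD).1)
              (fun j hj hj' hjP => ihm j hj' hj (by omega) hjP)
    have q2 : H.desc k (v t) → ∀ x m, t = m + x → s < m → m < t → v m ∈ H.pa k →
        H.E (v m) (v t) := by
      intro htD x
      induction x using Nat.strong_induction_on with
      | _ x ihm =>
      intro m htx hsm hmt hmP
      rcases lt_trichotomy m r with h | h | h
      · have hmz := (p1 m hsm h hmP).2 hrD
        have hmD : ¬ H.desc k (v m) := fun hd => hexc _ hd hmP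
        rcases a2 with a2 | a2
        · rw [← a2]; exact hmz
        · have htz := orientf _ _ (hfr.2 htD) (adj_symm a2)
          by_contra hno
          have hnadj : ¬ H.adj (v m) (v t) := fun hadj => hno (orient _ _ hmD htD hadj)
          refine h3 (v m) (v r) (v t) ⟨hmz, htz, hnadj, ?_⟩ ?_ ?_
          · intro h; rw [h] at hmD; exact hmD htD
          · exact fun hd => hmD (htD.trans hd)
          · exact act (v t) m t hmt.le (by omega)
              (fun j hj hj' hjD => (hD j (by omega) hj' hjD).2 htD)
              (fun j hj hj' hjP => ihm (t - j) (by omega) j (by omega) (by omega) hj' hjP)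
      · subst h
        exact (hexc _ hrD hmP).elim
      · exact (p2 m h hmt hmP).2 htD
    refine ⟨?_, fun m hsm hmt hmP => ⟨q1 m hsm hmt hmP,
      fun htD => q2 htD (t - m) m (by omega) hsm hmt hmP⟩⟩
    rcases a1 with a1 | a1
    · rw [a1]; exact a2
    rcases a2 with a2 | a2
    · rw [← a2]; exact Or.inr a1
    have hsz := orientf _ _ hfr.1 a1
    have htz : H.E (v t) (v r) := by
      by_cases htD : H.desc k (v t)
      · exact orientf _ _ (hfr.2 htD) (adj_symm a2)
      · exact orient _ _ htD hrD (adj_symm a2)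
    by_contra hcon
    push Not at hcon
    obtain ⟨hne, hnadj⟩ := hcon
    by_cases hd : H.desc (v s) (v t)
    · have htD : H.desc k (v t) := hs.trans hd
      refine h3 (v s) (v r) (v t) ⟨hsz, htz, hnadj, hne⟩ ?_ ?_
      · intro hd'
        rcases Relation.ReflTransGen.cases_head hd with h | ⟨c, hc, hc'⟩
        · exact hne h
        · exact no_desc hc (hc'.trans hd')
      · exact act (v t) s t hst.le htn (fun j hj hj' hjD => (hD j hj hj' hjD).2 htD)
          (fun j hj hj' hjP => q2 htD (t - j) j (by omega) hj hj' hjP)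
    · refine h3 (v t) (v r) (v s) ⟨htz, hsz, fun h => hnadj (adj_symm h), hne.symm⟩ hd
        (WC.symm ?_)
      exact act (v s) s t hst.le htn (fun j hj hj' hjD => (hD j hj hj' hjD).1) q1
  · have hP : ∀ m, s < m → m < t → v m ∈ H.pa k := by
      intro m hm hm'
      rcases hint m (by omega) with h | h
      · exact absurd ⟨m, by simp [hm, hm'], h⟩ hex
      · exact h
    rcases Nat.lt_or_ge t (s + 2) with h | h
    · have : t = s + 1 := by omega
      subst this
      exact ⟨Or.inr (h1 _ _ (hA.1 s (by omega))), by intro m _ _; omega⟩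
    · have hcol := (hA.2 s (by omega)).2 (hP (s + 1) (by omega) (by omega))
      rcases Nat.lt_or_ge t (s + 3) with h' | h'
      · have : t = s + 2 := by omega
        subst this
        have hpk := hP (s + 1) (by omega) (by omega)
        have hpD : ¬ H.desc k (v (s + 1)) := fun hd => hexc _ hd hpk
        have hps : H.E (v (s + 1)) (v s) :=
          orient _ _ hpD hs (adj_symm (h1 _ _ (Or.inl hcol.1)))
        refine ⟨?_, fun m hm hm' _ => ?_⟩
        · by_contra hcon
          push Not at hcon
          have := h2 _ _ _ hcol.1 hcol.2 hcon.1 hcon.2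
          exact no_two this.1 hps
        · have : m = s + 1 := by omega
          subst this
          exact ⟨hps, fun htD => orient _ _ hpD htD (adj_symm (h1 _ _ (Or.inl hcol.2)))⟩
      · have hcol2 := (hA.2 (s + 1) (by omega)).2 (hP (s + 2) (by omega) (by omega))
        exact (no_two hcol.2 hcol2.1).elim

theorem local_of_conds {H G : DAG p} (h1 : skeletonSub G H)
    (h2 : ∀ i j k, G.E i j → G.E k j → i ≠ k → ¬ H.adj i k → H.collider i j k)
    (h3 : ∀ i j k, H.vstruct i j k → ¬ H.desc k i → ¬ G.WC (H.pa k) i k) :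
    ∀ k i, ¬ H.desc k i → ¬ H.E i k → ¬ G.WC (H.pa k) k i := by
  classical
  obtain ⟨f, -, hf⟩ := exists_top H
  rintro k i hd hE ⟨v, n, h0, hn, hA⟩
  have hex : ∃ m, m ≤ n ∧ ¬ H.desc k (v m) ∧ ¬ H.E (v m) k :=
    ⟨n, le_rfl, by rwa [hn], by rwa [hn]⟩
  obtain ⟨hm, hmd, hmE⟩ := Nat.find_spec hex
  have hmin := fun m => Nat.find_min (H := hex) (m := m)
  generalize Nat.find hex = N at hm hmd hmE hmin
  have hA' := hA.sub 0 N (by omega)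
  simp only [zero_add] at hA'
  have hN : 0 < N := by
    rcases Nat.eq_zero_or_pos N with rfl | h
    · rw [h0] at hmd
      exact absurd Relation.ReflTransGen.refl hmd
    · exact h
  have hk : H.desc k (v 0) := by rw [h0]; exact Relation.ReflTransGen.refl
  have := (seg hf h1 h2 h3 hA' hmd (by
      intro m hmN
      have := hmin m hmN
      by_contra hcon
      push Not at hcon
      exact this ⟨by omega, hcon.1, hcon.2⟩) N 0 N (by omega) hN le_rfl hk (Or.inr rfl) (by
      intro m _ _ hmD
      refine ⟨?_, fun h => absurd h hmd⟩
      rw [h0]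
      exact f_desc hf hmD)).1
  rw [h0] at this
  rcases this with h | h | h
  · exact hmd (h ▸ Relation.ReflTransGen.refl)
  · exact hmd (Relation.ReflTransGen.single h)
  · exact hmE h

/-- Soundness of a separating parent set. -/
theorem dSep_pa {H : DAG p} {i k : Fin p} (hne : i ≠ k) (hnd : ¬ H.desc k i)
    (hp : ¬ H.E i k) : H.dSep i k (H.pa k) :=
  fun h => local_markov hne hnd hp (wc_of_dConn (by exact hp) h).symm

theorem not_indepMap_of {H G : DAG p} {i k : Fin p} (hne : i ≠ k) (hnd : ¬ H.desc k i)
    (hp : ¬ H.E i k) (hG : G.dConn i k (H.pa k)) : ¬ H.IndepMap G := by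
  intro hI
  refine hI {i} {k} (H.pa k) ?_ ?_ ?_ ?_ i rfl k rfl hG
  · simpa using hne
  · simpa [pa] using hp
  · simpa [pa] using fun h => no_loop h
  · rintro _ rfl _ rfl
    exact dSep_pa hne hnd hp

theorem desc_antisymm {H : DAG p} {i k : Fin p} (hne : i ≠ k) (h : H.desc i k) :
    ¬ H.desc k i := by
  intro h'
  rcases Relation.ReflTransGen.cases_head h with h | ⟨c, hc, hc'⟩
  · exact hne h
  · exact no_desc hc (hc'.trans h')

end DAG

open DAG in
/-- **Theorem (characterization of independence maps).** A DAG `H` is not an independence map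
of a DAG `G` if and only if (1) the skeleton of `G` is not a subgraph of the skeleton of `H`, or
(2) there is a triple `(i, j, k)` with `i, k` non-adjacent in `H`, `(i, j, k)` a non-collider
path in `H` and a v-structure in `G`, or (3) there is a v-structure `(i, j, k)` in `H` with
`i` a non-descendant of `k` in `H` and `i` d-connected to `k` given `Pa_H(k)` in `G`. -/
theorem not_indepMap_iff {p : ℕ} (H G : DAG p) :
    ¬ H.IndepMap G ↔
      (¬ skeletonSub G H) ∨
      (∃ i j k : Fin p, ¬ H.adj i k ∧ H.nonColliderTriple i j k ∧ G.vstruct i j k) ∨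
      (∃ i j k : Fin p, H.vstruct i j k ∧ i ∈ H.nd k ∧ G.dConn i k (H.pa k)) := by
  constructor
  · intro hI
    by_contra hcon
    push Not at hcon
    obtain ⟨h1, h2, h3⟩ := hcon
    apply hI
    have h2' : ∀ i j k, G.E i j → G.E k j → i ≠ k → ¬ H.adj i k → H.collider i j k := by
      intro i j k hi hk hne hadj
      by_contra hc
      exact h2 i j k hadj ⟨h1 _ _ (Or.inl hi), adj_symm (h1 _ _ (Or.inl hk)), hne,
        ne_of_adj (h1 _ _ (Or.inl hi)), ne_of_adj (adj_symm (h1 _ _ (Or.inl hk))), hc⟩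
        ⟨hi, hk, fun h => hadj (h1 _ _ h), hne⟩
    have h3' : ∀ i j k, H.vstruct i j k → ¬ H.desc k i → ¬ G.WC (H.pa k) i k :=
      fun i j k hv hd hw => h3 i j k hv hd (dConn_of_wc hv.2.2.2 hw)
    have hloc := local_of_conds h1 h2' h3'
    obtain ⟨f, hinj, hf⟩ := exists_top H
    intro W₁ W₂ S d1 d2 d3 hH i hi k hk hG
    have hne : i ≠ k := fun h => Set.disjoint_left.1 d1 hi (h ▸ hk)
    have hiS : i ∉ S := Set.disjoint_left.1 d2 hi
    have hkS : k ∉ S := Set.disjoint_left.1 d3 hk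
    have hM : ∀ x, f x < Finset.univ.sup f + 1 :=
      fun x => Nat.lt_succ_of_le (Finset.le_sup (Finset.mem_univ x))
    exact global_of_local hinj hf hloc (Finset.univ.sup f + 1) i k S hne hiS hkS (hM _) (hM _)
      (fun c _ => hM c) (fun hw => hH i hi k hk (dConn_of_wc hne hw)) (wc_of_dConn hiS hG)
  · have one : ∀ (i k : Fin p) (S : Set (Fin p)), G.adj i k → G.dConn i k S :=
      fun i k S h => dConn_of_wc (ne_of_adj h) ⟨_, 1, by simp, by simp, Act.single h⟩
    have two : ∀ i j k : Fin p, ¬ H.desc k i → ¬ H.adj i k → H.nonColliderTriple i j k →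
        G.vstruct i j k → ¬ H.IndepMap G := by
      intro i j k hd hadj hn hv
      have hik : ¬ H.E i k := fun h => hadj (Or.inl h)
      refine not_indepMap_of hv.2.2.2 hd hik ?_
      have hj : H.E j k := by
        by_contra hj
        have hkj : H.E k j := hn.2.1.resolve_left hj
        have hji : H.E j i := hn.1.resolve_left (fun h => hn.2.2.2.2.2 ⟨h, hkj⟩)
        exact hd ((Relation.ReflTransGen.single hkj).tail hji)
      refine dConn_of_wc hv.2.2.2 ?_
      have := Act.concat (Act.single (S := H.pa k) (Or.inl hv.1 : G.adj i j))
        (Act.single (S := H.pa k) (Or.inr hv.2.1 : G.adj j k)) (by simp) (by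
          intro _ _
          simp only [one_ne_zero, if_false, Nat.sub_self, if_true]
          exact ⟨fun _ => hj, fun _ => ⟨hv.1, hv.2.1⟩⟩)
      simpa using this
    rintro (h | ⟨i, j, k, hadj, hn, hv⟩ | ⟨i, j, k, hv, hd, hG⟩)
    · simp only [skeletonSub, not_forall] at h
      obtain ⟨i, k, hG, hH⟩ := h
      by_cases hd : H.desc k i
      · exact not_indepMap_of (ne_of_adj hG).symm (desc_antisymm (ne_of_adj hG).symm hd)
          (fun h => hH (Or.inr h)) (one _ _ _ (adj_symm hG))
      · exact not_indepMap_of (ne_of_adj hG) hd (fun h => hH (Or.inl h)) (one _ _ _ hG)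
    · by_cases hd : H.desc k i
      · obtain ⟨n1, n2, n3, n4, n5, n6⟩ := hn
        exact two k j i (desc_antisymm n3.symm hd) (fun h => hadj (adj_symm h))
          ⟨adj_symm n2, adj_symm n1, n3.symm, n5.symm, n4.symm, fun h => n6 ⟨h.2, h.1⟩⟩
          ⟨hv.2.1, hv.1, fun h => hv.2.2.1 (adj_symm h), hv.2.2.2.symm⟩
      · exact two i j k hd hadj hn hv
    · exact not_indepMap_of hv.2.2.2 hd (fun h => hv.2.2.1 (Or.inl h)) hG
end

section
/- Let Z ~ N(0, Σ) with Σ a positive definite correlation matrix, and let g_1,...,g_p be strictly increasing functions with X_i = g_i(Z_i). Then for any i ≠ j and S ⊆ {1,...,p} \ {i,j}: X_i is conditionally independent of X_j given {X_r : r ∈ S} if and only if Z_i is conditionally independent of Z_j given {Z_r : r ∈ S}, if and only if the partial correlation ρ_{ij|S} (computed from Σ) is zero. -/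
open Finset

/-- The principal submatrix of `V` indexed by the finite set `S`. -/
noncomputable def subCov {p : ℕ} (V : Matrix (Fin p) (Fin p) ℝ) (S : Finset (Fin p)) :
    Matrix S S ℝ := Matrix.of fun a b => V a.1 b.1

/-- The conditional covariance of coordinates `i` and `j` given the coordinates in `S`
(Schur complement formula). -/
noncomputable def condCov {p : ℕ} (V : Matrix (Fin p) (Fin p) ℝ) (S : Finset (Fin p))
    (i j : Fin p) : ℝ :=
  V i j - ∑ a : S, ∑ b : S, V i a.1 * (subCov V S)⁻¹ a b * V b.1 j

/-- The partial correlation between coordinates `i` and `j` given the coordinates in `S`. -/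
noncomputable def parcor {p : ℕ} (V : Matrix (Fin p) (Fin p) ℝ) (S : Finset (Fin p))
    (i j : Fin p) : ℝ :=
  condCov V S i j / Real.sqrt (condCov V S i i * condCov V S j j)

open MeasureTheory ProbabilityTheory

variable {Ω : Type*}

/-- `X` is a mean-zero multivariate Gaussian random vector with covariance matrix `V`:
every linear combination of its coordinates has a centered Gaussian distribution with the
corresponding variance. -/
def IsGaussianVec {p : ℕ} [MeasurableSpace Ω] (μ : Measure Ω) (X : Fin p → Ω → ℝ)
    (V : Matrix (Fin p) (Fin p) ℝ) : Prop :=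
  (∀ i, Measurable (X i)) ∧
    ∀ a : Fin p → ℝ,
      Measure.map (fun ω => ∑ i, a i * X i ω) μ =
        gaussianReal 0 (Real.toNNReal (∑ i, ∑ j, a i * a j * V i j))

/-- The σ-algebra generated by the family of random variables `{X r : r ∈ S}`. -/
def sigmaOf {p : ℕ} [MeasurableSpace Ω] (X : Fin p → Ω → ℝ) (S : Finset (Fin p)) :
    MeasurableSpace Ω :=
  MeasurableSpace.comap (fun ω => fun r : S => X r.1 ω) inferInstance

lemma sigmaOf_le {p : ℕ} [m : MeasurableSpace Ω] {X : Fin p → Ω → ℝ}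
    (hX : ∀ i, Measurable (X i)) (S : Finset (Fin p)) : sigmaOf X S ≤ m :=
  (measurable_pi_lambda (fun ω => fun r : S => X r.1 ω) (fun r : S => hX r.1)).comap_le

/-- `X i` and `X j` are conditionally independent given `{X r : r ∈ S}`. -/
def CondIndepCoord {p : ℕ} [MeasurableSpace Ω] [StandardBorelSpace Ω] (μ : Measure Ω)
    [IsFiniteMeasure μ] (X : Fin p → Ω → ℝ) (hX : ∀ i, Measurable (X i))
    (i j : Fin p) (S : Finset (Fin p)) : Prop :=
  CondIndepFun (sigmaOf X S) (sigmaOf_le hX S) (X i) (X j) μ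


open MeasureTheory ProbabilityTheory
open scoped Matrix

section Npn

lemma condIndepFun_prodMk_left_aux {Ω β β' γ : Type*} {m' : MeasurableSpace Ω}
    [mΩ : MeasurableSpace Ω] [StandardBorelSpace Ω] {hm' : m' ≤ mΩ} {μ : Measure Ω}
    [IsFiniteMeasure μ] [mβ : MeasurableSpace β] [mβ' : MeasurableSpace β']
    [mγ : MeasurableSpace γ] {f : Ω → β} {g : Ω → β'} {W : Ω → γ}
    (hf : Measurable f) (hg : Measurable g) (hW : Measurable[m'] W)
    (h : CondIndepFun m' hm' f g μ) :
    CondIndepFun m' hm' (fun ω => (f ω, W ω)) g μ := by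
  have hW' : Measurable W := hW.mono hm' le_rfl
  have hfW : Measurable (fun ω => (f ω, W ω)) := hf.prodMk hW'
  rw [condIndepFun_iff _ hm' _ _ hf hg] at h
  rw [condIndepFun_iff_condIndep]
  refine CondIndepSets.condIndep hfW.comap_le hg.comap_le
    (isPiSystem_prod.comap (fun ω => (f ω, W ω)))
    (@MeasurableSpace.isPiSystem_measurableSet Ω (MeasurableSpace.comap g mβ')) ?_
    (@MeasurableSpace.generateFrom_measurableSet Ω (MeasurableSpace.comap g mβ')).symm ?_
  · rw [← generateFrom_prod, MeasurableSpace.comap_generateFrom]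
    rfl
  rw [condIndepSets_iff]
  · rintro _ t2 ⟨_, ⟨A, hA, C, hC, rfl⟩, rfl⟩ ht2
    have hC' : MeasurableSet[m'] (W ⁻¹' C) := hW hC
    have hA' : MeasurableSet (f ⁻¹' A) := hf hA
    have ht2' : MeasurableSet t2 := hg.comap_le _ ht2
    have h1 := h (f ⁻¹' A) t2 ⟨A, hA, rfl⟩ ht2
    have e1 : ((fun ω => (f ω, W ω)) ⁻¹' A ×ˢ C) = W ⁻¹' C ∩ f ⁻¹' A := by
      ext ω; simp [and_comm]
    have h2 : μ⟦W ⁻¹' C ∩ f ⁻¹' A | m'⟧ =ᵐ[μ] (W ⁻¹' C).indicator (μ⟦f ⁻¹' A | m'⟧) := by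
      rw [← Set.indicator_indicator]
      exact condExp_indicator ((integrable_const _).indicator hA') hC'
    have h3 : μ⟦W ⁻¹' C ∩ (f ⁻¹' A ∩ t2) | m'⟧ =ᵐ[μ]
        (W ⁻¹' C).indicator (μ⟦f ⁻¹' A ∩ t2 | m'⟧) := by
      rw [← Set.indicator_indicator]
      exact condExp_indicator ((integrable_const _).indicator (hA'.inter ht2')) hC'
    rw [e1, Set.inter_assoc]
    filter_upwards [h1, h2, h3] with ω h1 h2 h3
    rw [h3, Pi.mul_apply, h2]
    by_cases hω : ω ∈ W ⁻¹' C
    · simp only [Set.indicator_of_mem hω]; rw [h1]; rfl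
    · simp only [Set.indicator_of_notMem hω, zero_mul]
  · rintro _ ⟨_, ⟨A, hA, C, hC, rfl⟩, rfl⟩
    exact hfW (hA.prod hC)
  · intro s hs
    exact hg.comap_le _ hs

lemma condIndepFun_prodMk_aux {Ω β β' γ : Type*} {m' : MeasurableSpace Ω}
    [mΩ : MeasurableSpace Ω] [StandardBorelSpace Ω] {hm' : m' ≤ mΩ} {μ : Measure Ω}
    [IsFiniteMeasure μ] [mβ : MeasurableSpace β] [mβ' : MeasurableSpace β']
    [mγ : MeasurableSpace γ] {f : Ω → β} {g : Ω → β'} {W : Ω → γ}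
    (hf : Measurable f) (hg : Measurable g) (hW : Measurable[m'] W)
    (h : CondIndepFun m' hm' f g μ) :
    CondIndepFun m' hm' (fun ω => (f ω, W ω)) (fun ω => (g ω, W ω)) μ := by
  have hW' : Measurable W := hW.mono hm' le_rfl
  have h1 := condIndepFun_prodMk_left_aux hf hg hW h
  exact (condIndepFun_prodMk_left_aux hg (hf.prodMk hW') hW h1.symm).symm

/-- If `(f, g)` is independent of `m'`, conditional independence is independence. -/
lemma condIndepFun_iff_of_indep_aux {Ω β β' : Type*} {m' : MeasurableSpace Ω}
    [mΩ : MeasurableSpace Ω] [StandardBorelSpace Ω] {hm' : m' ≤ mΩ} {μ : Measure Ω}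
    [IsProbabilityMeasure μ] [mβ : MeasurableSpace β] [mβ' : MeasurableSpace β']
    {f : Ω → β} {g : Ω → β'} (hf : Measurable f) (hg : Measurable g)
    (hind : Indep (MeasurableSpace.comap (fun ω => (f ω, g ω)) inferInstance) m' μ) :
    CondIndepFun m' hm' f g μ ↔ IndepFun f g μ := by
  have hfg : Measurable (fun ω => (f ω, g ω)) := hf.prodMk hg
  have key : ∀ D : Set (β × β'), MeasurableSet D →
      μ⟦(fun ω => (f ω, g ω)) ⁻¹' D | m'⟧ =ᵐ[μ]
        fun _ => μ.real ((fun ω => (f ω, g ω)) ⁻¹' D) := by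
    intro D hD
    have := condExp_indep_eq (μ := μ) (m₂ := m')
      (f := ((fun ω => (f ω, g ω)) ⁻¹' D).indicator fun _ => (1 : ℝ)) hfg.comap_le hm'
      (stronglyMeasurable_const.indicator ⟨D, hD, rfl⟩) hind
    refine this.trans (Filter.Eventually.of_forall fun ω => ?_)
    simp only
    rw [integral_indicator_const _ (hfg hD)]
    simp
  rw [condIndepFun_iff_condExp_inter_preimage_eq_mul hf hg,
    indepFun_iff_measure_inter_preimage_eq_mul]
  refine forall_congr' fun s => forall_congr' fun t => forall_congr' fun hs =>
    forall_congr' fun ht => ?_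
  have k1 := key (s ×ˢ t) (hs.prod ht)
  have k2 := key (s ×ˢ Set.univ) (hs.prod .univ)
  have k3 := key (Set.univ ×ˢ t) (MeasurableSet.univ.prod ht)
  simp only [Set.mk_preimage_prod, Set.preimage_univ, Set.inter_univ, Set.univ_inter] at k1 k2 k3
  have e : (μ (f ⁻¹' s ∩ g ⁻¹' t) = μ (f ⁻¹' s) * μ (g ⁻¹' t)) ↔
      μ.real (f ⁻¹' s ∩ g ⁻¹' t) = μ.real (f ⁻¹' s) * μ.real (g ⁻¹' t) := by
    rw [Measure.real, Measure.real, Measure.real, ← ENNReal.toReal_mul,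
      ENNReal.toReal_eq_toReal_iff' (by finiteness) (by finiteness)]
  rw [e]
  constructor
  · intro h
    obtain ⟨ω, h, k1, k2, k3⟩ := (h.and (k1.and (k2.and k3))).exists
    simp only at h k1 k2 k3
    rw [← k1, ← k2, ← k3, h]
  · intro h
    filter_upwards [k1, k2, k3] with ω k1 k2 k3
    rw [k1, k2, k3, h]

/-- Linear combinations of the coordinates. -/
noncomputable def linComb {Ω : Type*} {p : ℕ} (Z : Fin p → Ω → ℝ) (a : Fin p → ℝ) (ω : Ω) : ℝ :=
  ∑ i, a i * Z i ω

lemma gaussVec_hasGaussianLaw {Ω : Type*} [MeasurableSpace Ω] {μ : Measure Ω} {p : ℕ}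
    {Z : Fin p → Ω → ℝ} {V : Matrix (Fin p) (Fin p) ℝ} (h : IsGaussianVec μ Z V) :
    HasGaussianLaw (fun ω => (Z · ω)) μ where
  isGaussian_map := by
    refine isGaussian_of_map_eq_gaussianReal fun L => ?_
    have e : (L ∘ fun ω => (Z · ω)) = fun ω => ∑ i, L (Pi.single i 1) * Z i ω := by
      ext ω
      have h1 : (fun x => Z x ω) = ∑ i, Z i ω • (Pi.single i 1 : Fin p → ℝ) := by
        ext k
        simp [Finset.sum_apply, Pi.single_apply]
      change L (fun x => Z x ω) = _
      rw [h1, map_sum]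
      simp [mul_comm]
    refine ⟨0, Real.toNNReal (∑ i, ∑ j, L (Pi.single i 1) * L (Pi.single j 1) * V i j), ?_⟩
    rw [Measure.map_map L.continuous.measurable (measurable_pi_lambda _ h.1), e]
    exact h.2 (fun i => L (Pi.single i 1))

lemma linComb_pair_hasGaussianLaw {Ω κ κ' : Type*} [Fintype κ] [Fintype κ'] [MeasurableSpace Ω]
    {μ : Measure Ω} {p : ℕ}
    {Z : Fin p → Ω → ℝ} {V : Matrix (Fin p) (Fin p) ℝ} (h : IsGaussianVec μ Z V)
    (c : κ → Fin p → ℝ) (d : κ' → Fin p → ℝ) :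
    HasGaussianLaw (fun ω => (fun k => linComb Z (c k) ω, fun k => linComb Z (d k) ω)) μ := by
  let A : (Fin p → ℝ) →L[ℝ] (κ → ℝ) := ContinuousLinearMap.pi fun k =>
    ∑ i, c k i • ContinuousLinearMap.proj (R := ℝ) (φ := fun _ : Fin p => ℝ) i
  let B : (Fin p → ℝ) →L[ℝ] (κ' → ℝ) := ContinuousLinearMap.pi fun k =>
    ∑ i, d k i • ContinuousLinearMap.proj (R := ℝ) (φ := fun _ : Fin p => ℝ) i
  have := (gaussVec_hasGaussianLaw h).map_fun (A.prod B)
  have e : (fun ω => (A.prod B) fun x => Z x ω) =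
      fun ω => (fun k => linComb Z (c k) ω, fun k => linComb Z (d k) ω) := by
    ext ω k <;> simp [A, B, linComb]
  rw [e] at this
  exact this

lemma linComb_memLp {Ω : Type*} [MeasurableSpace Ω] {μ : Measure Ω} {p : ℕ}
    {Z : Fin p → Ω → ℝ} {V : Matrix (Fin p) (Fin p) ℝ} (h : IsGaussianVec μ Z V)
    (a : Fin p → ℝ) : MemLp (linComb Z a) 2 μ := by
  have := linComb_pair_hasGaussianLaw h (fun _ : Unit => a) (fun _ : Unit => a)
  exact (this.fst.eval ()).memLp_two

lemma linComb_variance {Ω : Type*} [MeasurableSpace Ω] {μ : Measure Ω} {p : ℕ}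
    {Z : Fin p → Ω → ℝ} {V : Matrix (Fin p) (Fin p) ℝ} (h : IsGaussianVec μ Z V)
    (hV : V.PosDef) (a : Fin p → ℝ) : Var[linComb Z a; μ] = a ⬝ᵥ V *ᵥ a := by
  have h1 := h.2 a
  have hm : Measurable (linComb Z a) :=
    Finset.measurable_sum _ fun i _ => (h.1 i).const_mul _
  have h2 : Var[id; μ.map (linComb Z a)] = Var[linComb Z a; μ] := by
    rw [variance_map aemeasurable_id hm.aemeasurable]; rfl
  have h3 : (∑ i, ∑ j, a i * a j * V i j) = a ⬝ᵥ V *ᵥ a := by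
    simp only [dotProduct, Matrix.mulVec, Finset.mul_sum]
    exact Finset.sum_congr rfl fun i _ => Finset.sum_congr rfl fun j _ => by ring
  have h4 : 0 ≤ a ⬝ᵥ V *ᵥ a := by simpa using hV.posSemidef.dotProduct_mulVec_nonneg a
  rw [← h2]
  change Var[id; μ.map (fun ω => ∑ i, a i * Z i ω)] = _
  rw [h1, variance_id_gaussianReal, h3, Real.coe_toNNReal _ h4]

lemma linComb_cov {Ω : Type*} [MeasurableSpace Ω] {μ : Measure Ω} [IsProbabilityMeasure μ] {p : ℕ}
    {Z : Fin p → Ω → ℝ} {V : Matrix (Fin p) (Fin p) ℝ} (h : IsGaussianVec μ Z V)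
    (hV : V.PosDef) (a b : Fin p → ℝ) : cov[linComb Z a, linComb Z b; μ] = a ⬝ᵥ V *ᵥ b := by
  have h1 := variance_add (linComb_memLp h a) (linComb_memLp h b)
  have h2 : linComb Z a + linComb Z b = linComb Z (a + b) := by
    ext ω; simp [linComb, add_mul, Finset.sum_add_distrib]
  have h3 : b ⬝ᵥ V *ᵥ a = a ⬝ᵥ V *ᵥ b := by
    have hs : Vᵀ = V := by simpa using hV.isHermitian.eq
    rw [Matrix.dotProduct_mulVec, ← Matrix.mulVec_transpose, hs, dotProduct_comm]
  rw [h2, linComb_variance h hV, linComb_variance h hV, linComb_variance h hV] at h1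
  simp only [Matrix.mulVec_add, dotProduct_add, add_dotProduct] at h1
  linarith

/-- Coefficients of the residual of `Z i` after regression on `Z_S`. -/
noncomputable def resCoef {p : ℕ} (V : Matrix (Fin p) (Fin p) ℝ) (S : Finset (Fin p))
    (i : Fin p) : Fin p → ℝ :=
  Pi.single i 1 - ∑ a : S, ((fun b : S => V i b.1) ᵥ* (subCov V S)⁻¹) a • Pi.single a.1 1

lemma mulVec_resCoef {p : ℕ} {V : Matrix (Fin p) (Fin p) ℝ} (hV : V.PosDef)
    (S : Finset (Fin p)) (i : Fin p) (k : Fin p) :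
    Pi.single k 1 ⬝ᵥ V *ᵥ resCoef V S i = condCov V S i k := by
  have hs : ∀ i j, V i j = V j i := fun i j => by simpa using (hV.isHermitian.apply i j).symm
  simp only [resCoef, Matrix.mulVec_sub, Matrix.mulVec_sum, Matrix.mulVec_smul, condCov,
    single_one_dotProduct, Pi.sub_apply, Finset.sum_apply, Pi.smul_apply,
    Matrix.mulVec_single_one, Matrix.col_apply, smul_eq_mul]
  rw [hs k i]
  congr 1
  rw [Finset.sum_comm]
  refine Finset.sum_congr rfl fun a _ => ?_
  simp only [Matrix.vecMul, dotProduct, Finset.sum_mul]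
  exact Finset.sum_congr rfl fun b _ => by rw [hs k]

lemma condCov_mem {p : ℕ} {V : Matrix (Fin p) (Fin p) ℝ} (hV : V.PosDef)
    (S : Finset (Fin p)) (i : Fin p) (k : S) : condCov V S i k = 0 := by
  have hP : (subCov V S).PosDef := hV.submatrix (e := fun a : S => a.1) Subtype.val_injective
  have hu : IsUnit (subCov V S).det := hP.det_pos.ne'.isUnit
  have h1 : ((fun b : S => V i b.1) ᵥ* (subCov V S)⁻¹ ᵥ* subCov V S) k = V i k := by
    rw [Matrix.vecMul_vecMul, Matrix.nonsing_inv_mul _ hu, Matrix.vecMul_one]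
  rw [condCov, sub_eq_zero, ← h1, Finset.sum_comm]
  simp only [Matrix.vecMul, dotProduct, Finset.sum_mul, subCov, Matrix.of_apply]

lemma resCoef_dot {p : ℕ} {V : Matrix (Fin p) (Fin p) ℝ} (hV : V.PosDef)
    (S : Finset (Fin p)) (i j : Fin p) :
    resCoef V S j ⬝ᵥ V *ᵥ resCoef V S i = condCov V S i j := by
  conv_lhs => rw [resCoef]
  rw [sub_dotProduct, sum_dotProduct, mulVec_resCoef hV, Finset.sum_eq_zero, sub_zero]
  intro a _
  rw [smul_dotProduct, mulVec_resCoef hV, condCov_mem hV, smul_zero]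

lemma condCov_self_pos {p : ℕ} {V : Matrix (Fin p) (Fin p) ℝ} (hV : V.PosDef)
    (S : Finset (Fin p)) (i : Fin p) (hi : i ∉ S) : 0 < condCov V S i i := by
  rw [← resCoef_dot hV]
  have hne : resCoef V S i ≠ 0 := by
    intro h
    have h1 := congrFun h i
    simp only [resCoef, Pi.sub_apply, Pi.single_eq_same, Finset.sum_apply, Pi.smul_apply,
      Pi.zero_apply] at h1
    rw [Finset.sum_eq_zero] at h1
    · norm_num at h1
    · intro a _
      rw [Pi.single_eq_of_ne (by rintro rfl; exact hi a.2), smul_zero]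
  simpa using hV.dotProduct_mulVec_pos hne

lemma parcor_eq_zero_iff {p : ℕ} {V : Matrix (Fin p) (Fin p) ℝ} (hV : V.PosDef)
    (S : Finset (Fin p)) (i j : Fin p) (hi : i ∉ S) (hj : j ∉ S) :
    parcor V S i j = 0 ↔ condCov V S i j = 0 := by
  have := Real.sqrt_pos.2 (mul_pos (condCov_self_pos hV S i hi) (condCov_self_pos hV S j hj))
  rw [parcor, div_eq_zero_iff, or_iff_left this.ne']

lemma linComb_resCoef {Ω : Type*} {p : ℕ} (Z : Fin p → Ω → ℝ) (V : Matrix (Fin p) (Fin p) ℝ)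
    (S : Finset (Fin p)) (i : Fin p) (ω : Ω) :
    linComb Z (resCoef V S i) ω =
      Z i ω - ∑ a : S, ((fun b : S => V i b.1) ᵥ* (subCov V S)⁻¹) a * Z a.1 ω := by
  change resCoef V S i ⬝ᵥ (fun k => Z k ω) = _
  rw [resCoef, sub_dotProduct, sum_dotProduct]
  simp [smul_dotProduct]

lemma gauss_condIndep_iff {Ω : Type*} [MeasurableSpace Ω] [StandardBorelSpace Ω]
    (μ : Measure Ω) [IsProbabilityMeasure μ] {p : ℕ}
    (Z : Fin p → Ω → ℝ) (hZ : ∀ i, Measurable (Z i))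
    (V : Matrix (Fin p) (Fin p) ℝ) (hV : V.PosDef) (hgauss : IsGaussianVec μ Z V)
    (i j : Fin p) (S : Finset (Fin p)) :
    CondIndepCoord μ Z hZ i j S ↔ condCov V S i j = 0 := by
  set R : Fin p → Ω → ℝ := fun k => linComb Z (resCoef V S k) with hR
  set W : Ω → S → ℝ := fun ω r => Z r.1 ω with hWdef
  set β : Fin p → S → ℝ := fun k => (fun b : S => V k b.1) ᵥ* (subCov V S)⁻¹ with hβ
  have hRm : ∀ k, Measurable (R k) := fun k =>
    Finset.measurable_sum _ fun i _ => (hZ i).const_mul _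
  have hWm : Measurable[sigmaOf Z S] W := comap_measurable W
  have hRe : ∀ k ω, R k ω = Z k ω - ∑ a : S, β k a * W ω a := fun k ω =>
    linComb_resCoef Z V S k ω
  have hWe : W = fun ω (r : S) => linComb Z (Pi.single r.1 1) ω := by
    ext ω r
    simp [W, linComb, Pi.single_apply]
  -- residuals are independent of `W`
  have hind : IndepFun (fun ω k => R k ω) W μ := by
    rw [hWe]
    refine HasGaussianLaw.indepFun_of_covariance_eval
      (X := fun k => linComb Z (resCoef V S k))
      (Y := fun r : S => linComb Z (Pi.single r.1 1))
      (linComb_pair_hasGaussianLaw hgauss _ _) fun k r => ?_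
    rw [covariance_comm, linComb_cov hgauss hV, mulVec_resCoef hV, condCov_mem hV]
  have hind2 : Indep (MeasurableSpace.comap (fun ω => (R i ω, R j ω)) inferInstance)
      (sigmaOf Z S) μ := by
    have := hind.comp (φ := fun x : Fin p → ℝ => (x i, x j)) (ψ := id)
      (by fun_prop) measurable_id
    exact (IndepFun_iff_Indep _ _ _).1 this
  have hcov : cov[R i, R j; μ] = condCov V S i j := by
    rw [covariance_comm, linComb_cov hgauss hV, resCoef_dot hV]
  have hRR : IndepFun (R i) (R j) μ ↔ condCov V S i j = 0 := by
    rw [← hcov]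
    refine ⟨fun h => h.covariance_eq_zero (linComb_memLp hgauss _) (linComb_memLp hgauss _),
      fun h => ?_⟩
    have h1 := (linComb_pair_hasGaussianLaw hgauss (fun k => resCoef V S k)
      (fun k => resCoef V S k)).fst.prodMk (X := R) i j
    exact h1.indepFun_of_covariance_eq_zero h
  rw [← hRR, ← condIndepFun_iff_of_indep_aux (hm' := sigmaOf_le hZ S) (hRm i) (hRm j) hind2]
  have hmeas : ∀ k, ∀ s : ℝ, Measurable
      (fun x : ℝ × (S → ℝ) => x.1 + s * ∑ a : S, β k a * x.2 a) := by
    intro k s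
    fun_prop
  unfold CondIndepCoord
  constructor
  · intro h
    have h1 := (condIndepFun_prodMk_aux (hZ i) (hZ j) hWm h).comp (hmeas i (-1)) (hmeas j (-1))
    convert h1 using 1 <;>
    · ext ω
      simp [hRe, Function.comp, sub_eq_add_neg]
  · intro h
    have h1 := (condIndepFun_prodMk_aux (hRm i) (hRm j) hWm h).comp (hmeas i 1) (hmeas j 1)
    convert h1 using 1 <;>
    · ext ω
      simp [hRe, Function.comp]

lemma sigmaOf_comp {Ω : Type*} [MeasurableSpace Ω] {p : ℕ}
    {Z X : Fin p → Ω → ℝ} {g : Fin p → ℝ → ℝ} (hg : ∀ i, StrictMono (g i))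
    (hX : ∀ i ω, X i ω = g i (Z i ω)) (S : Finset (Fin p)) : sigmaOf X S = sigmaOf Z S := by
  let G : (S → ℝ) → (S → ℝ) := fun x r => g r.1 (x r)
  have hGm : Measurable G := measurable_pi_lambda _ fun r =>
    (hg r.1).monotone.measurable.comp (measurable_pi_apply r)
  have hGi : Function.Injective G := fun x y h => funext fun r =>
    (hg r.1).injective (congrFun h r)
  have e : (fun ω => fun r : S => X r.1 ω) = G ∘ (fun ω => fun r : S => Z r.1 ω) := by
    ext ω r; simp [G, hX]
  rw [sigmaOf, e, ← MeasurableSpace.comap_comp, (hGm.measurableEmbedding hGi).comap_eq]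
  rfl

lemma comap_coord_comp {Ω : Type*} {z x : Ω → ℝ} {g : ℝ → ℝ} (hg : StrictMono g)
    (hx : ∀ ω, x ω = g (z ω)) :
    MeasurableSpace.comap x inferInstance = MeasurableSpace.comap z inferInstance := by
  rw [show x = g ∘ z from funext hx, ← MeasurableSpace.comap_comp,
    (hg.monotone.measurable.measurableEmbedding hg.injective).comap_eq]

lemma condIndep_congr_aux {Ω : Type*} [mΩ : MeasurableSpace Ω] [StandardBorelSpace Ω]
    (μ : Measure Ω) [IsFiniteMeasure μ] {m n a b c d : MeasurableSpace Ω} (hm : m ≤ mΩ)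
    (hn : n ≤ mΩ) (h1 : m = n) (h2 : a = c) (h3 : b = d) :
    CondIndep m a b hm μ ↔ CondIndep n c d hn μ := by
  subst h1 h2 h3; rfl

end Npn

open MeasureTheory ProbabilityTheory in
/-- **Conditional independence in the nonparanormal model.** Let `Z ~ N(0, V)` with `V` a
positive definite correlation matrix, let `g i` be strictly increasing functions, and let
`X i = g i ∘ Z i`. Then for all `i ≠ j` and `S ⊆ {1,…,p} \ {i,j}`: `X i` and `X j` are
conditionally independent given `{X r : r ∈ S}` iff `Z i` and `Z j` are conditionally
independent given `{Z r : r ∈ S}`, iff the partial correlation `ρ_{ij|S}` computed from `V`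
is zero. -/
theorem npn_condIndep_iff {Ω : Type*} [MeasurableSpace Ω] [StandardBorelSpace Ω]
    (μ : Measure Ω) [IsProbabilityMeasure μ] {p : ℕ}
    (Z : Fin p → Ω → ℝ) (hZ : ∀ i, Measurable (Z i))
    (V : Matrix (Fin p) (Fin p) ℝ) (hV : V.PosDef) (hcorr : ∀ i, V i i = 1)
    (hgauss : IsGaussianVec μ Z V)
    (g : Fin p → ℝ → ℝ) (hg : ∀ i, StrictMono (g i))
    (X : Fin p → Ω → ℝ) (hXdef : ∀ i ω, X i ω = g i (Z i ω)) :
    ∀ (i j : Fin p) (S : Finset (Fin p)), i ≠ j → i ∉ S → j ∉ S →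
      ((CondIndepCoord μ X
          (fun i => by
            rw [show X i = g i ∘ Z i from funext (hXdef i)]
            exact ((hg i).monotone.measurable).comp (hZ i))
          i j S ↔ CondIndepCoord μ Z hZ i j S) ∧
        (CondIndepCoord μ Z hZ i j S ↔ parcor V S i j = 0)) := by

  intro i j S _ hi hj
  refine ⟨?_, ?_⟩
  · unfold CondIndepCoord
    rw [condIndepFun_iff_condIndep, condIndepFun_iff_condIndep]
    exact condIndep_congr_aux μ _ _ (sigmaOf_comp hg hXdef S)
      (comap_coord_comp (hg i) (hXdef i)) (comap_coord_comp (hg j) (hXdef j))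
  · rw [parcor_eq_zero_iff hV S i j hi hj]
    exact gauss_condIndep_iff μ Z hZ V hV hgauss i j S
end
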